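/- arXiv:2404.00035 — 2 statements merged into one kernel-verified Lean document; each statement's English description precedes it below -/
import Mathlib

section
/- The 2D Hermite–Konhauser polynomials satisfy the biorthogonality relation ∫_0^∞ ∫_{-∞}^∞ e^{-X²-Y} Y^ρ · ₖH_n^ρ(X,Y) · Q_m(X,Y) dX dY = 2^n n! √π δ_{nm}, where Q_m(X,Y) = H_m(X) ∑_{j=0}^m Y_j^{(ρ)}(Y;Υ). -/
open MeasureTheory

/-- The Pochhammer (rising factorial) symbol. -/
noncomputable def poch (a : ℂ) (k : ℕ) : ℂ := ∏ i ∈ Finset.range k, (a + i)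

/-- The 2D Hermite–Konhauser polynomial `ₖH_n^ρ(X,Y)`. -/
noncomputable def hermiteKonhauser (ρ : ℝ) (Υ n : ℕ) (X Y : ℂ) : ℂ :=
  ∑ s ∈ Finset.range (n / 2 + 1), ∑ r ∈ Finset.range (n - s + 1),
    ((-1) ^ s * poch (-(n : ℂ)) (2 * s) * poch (-(n : ℂ)) (s + r)) /
      (poch (-(n : ℂ)) s * Complex.Gamma ((ρ : ℂ) + 1 + (Υ : ℂ) * r) *
        (s.factorial : ℂ) * (r.factorial : ℂ)) *
      (2 * X) ^ (n - 2 * s) * Y ^ (Υ * r)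

/-- The physicists' Hermite polynomial `H_n(X)`. -/
noncomputable def hermitePoly (n : ℕ) (X : ℂ) : ℂ :=
  ∑ s ∈ Finset.range (n / 2 + 1),
    (-1) ^ s * poch (-(n : ℂ)) (2 * s) / (s.factorial : ℂ) * (2 * X) ^ (n - 2 * s)

/-- The Konhauser biorthogonal polynomial `Y_m^{(ρ)}(t;Υ)`. -/
noncomputable def konhauserY (ρ : ℝ) (Υ m : ℕ) (t : ℂ) : ℂ :=
  (1 / (m.factorial : ℂ)) * ∑ i ∈ Finset.range (m + 1), t ^ i / (i.factorial : ℂ) *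
    ∑ j ∈ Finset.range (i + 1),
      (-1) ^ j * (i.choose j : ℂ) * poch (((j : ℂ) + ρ + 1) / Υ) m

/-- The second biorthogonal family `Q_m(X,Y) = H_m(X) ∑_{j=0}^m Y_j^{(ρ)}(Y;Υ)`. -/
noncomputable def hermiteKonhauserQ (ρ : ℝ) (Υ m : ℕ) (X Y : ℂ) : ℂ :=
  hermitePoly m X * ∑ j ∈ Finset.range (m + 1), konhauserY ρ Υ j Y

open Polynomial Finset

lemma poch_eq_ascPochhammer_eval (a : ℂ) (k : ℕ) : poch a k = (ascPochhammer ℂ k).eval a := by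
  induction k with
  | zero => simp [poch]
  | succ k ih => rw [ascPochhammer_succ_eval, ← ih, poch, prod_range_succ, ← poch]

lemma poch_neg_natCast (n k : ℕ) : poch (-(n : ℂ)) k = (-1) ^ k * n.descFactorial k := by
  rw [poch_eq_ascPochhammer_eval, ascPochhammer_eval_neg_eq_descPochhammer,
    descPochhammer_eval_eq_descFactorial]

lemma poch_add (a : ℂ) (j k : ℕ) : poch a (j + k) = poch a j * poch (a + j) k := by
  simp only [poch, prod_range_add, Nat.cast_add, add_assoc]

lemma poch_neg_natCast_ne_zero {n k : ℕ} (h : k ≤ n) : poch (-(n : ℂ)) k ≠ 0 := by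
  rw [poch_neg_natCast]
  have : n.descFactorial k ≠ 0 := by simpa [Nat.descFactorial_eq_zero_iff_lt] using h
  simpa using this

/-- Gauss–Newton interpolation of a polynomial at `-a`. -/
lemma sum_poch_mul_sum_choose (p : ℂ[X]) {m : ℕ} (hp : p.natDegree ≤ m) (a : ℂ) :
    ∑ i ∈ range (m + 1), poch a i / (i.factorial : ℂ) *
      ∑ j ∈ range (i + 1), (-1) ^ j * (i.choose j : ℂ) * p.eval (j : ℂ) = p.eval (-a) := by
  have hdiff (i : ℕ) : ∑ j ∈ range (i + 1), (-1) ^ j * (i.choose j : ℂ) * p.eval (j : ℂ) =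
      (-1) ^ i * ((fwdDiff 1)^[i] p.eval) 0 := by
    rw [fwdDiff_iter_eq_sum_shift, mul_sum]
    refine sum_congr rfl fun j hj ↦ ?_
    obtain ⟨k, rfl⟩ := Nat.exists_eq_add_of_le (mem_range_succ_iff.mp hj)
    have h1 : ((-1 : ℂ) ^ k) * (-1) ^ k = 1 := by rw [← mul_pow]; simp
    simp only [zsmul_eq_mul, nsmul_eq_mul, mul_one, zero_add, Nat.add_sub_cancel_left]
    push_cast
    rw [pow_add]
    linear_combination (-(-1) ^ j * ((j + k).choose j : ℂ) * p.eval (j : ℂ)) * h1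
  have key : ∑ i ∈ range (m + 1), C ((-1) ^ i * ((fwdDiff 1)^[i] p.eval) 0 / (i.factorial : ℂ)) *
      ascPochhammer ℂ i = p.comp (-X) := by
    refine eq_of_infinite_eval_eq _ _ (Set.Infinite.mono (s := Set.range fun N : ℕ ↦ -(N : ℂ)) ?_
      (Set.infinite_range_of_injective fun x y h ↦ by simpa using h))
    rintro _ ⟨N, rfl⟩
    have hN : p.eval (N : ℂ) =
        ∑ k ∈ range (N + 1), (N.choose k : ℂ) * ((fwdDiff 1)^[k] p.eval) 0 := by
      simpa using shift_eq_sum_fwdDiff_iter (1 : ℂ) p.eval N 0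
    have hterm (i : ℕ) : (-1) ^ i * ((fwdDiff 1)^[i] p.eval) 0 / (i.factorial : ℂ) *
        (ascPochhammer ℂ i).eval (-(N : ℂ)) = (N.choose i : ℂ) * ((fwdDiff 1)^[i] p.eval) 0 := by
      have h1 : ((-1 : ℂ) ^ i) * (-1) ^ i = 1 := by rw [← mul_pow]; simp
      have h2 : (i.factorial : ℂ) ≠ 0 := by exact_mod_cast i.factorial_ne_zero
      rw [← poch_eq_ascPochhammer_eval, poch_neg_natCast, Nat.descFactorial_eq_factorial_mul_choose]
      push_cast
      field_simp
      linear_combination ((N.choose i : ℂ) * ((fwdDiff 1)^[i] p.eval) 0) * h1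
    simp only [Set.mem_ofPred_eq, eval_finsetSum, eval_mul, eval_C, eval_comp, eval_neg, eval_X,
      neg_neg, hterm, hN]
    trans ∑ k ∈ range (m + N + 1), (N.choose k : ℂ) * ((fwdDiff 1)^[k] p.eval) 0
    · refine sum_subset (range_mono (by lia)) fun i _ hi ↦ ?_
      rw [fwdDiff_iter_eq_zero_of_degree_lt (by simp at hi; lia)]
      simp
    · refine (sum_subset (range_mono (by lia)) fun i _ hi ↦ ?_).symm
      rw [Nat.choose_eq_zero_of_lt (by simp at hi; lia)]
      simp
  have := congr_arg (eval a) key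
  simp only [eval_finsetSum, eval_mul, eval_C, eval_comp, eval_neg, eval_X] at this
  rw [← this]
  refine sum_congr rfl fun i _ ↦ ?_
  rw [hdiff, poch_eq_ascPochhammer_eval]
  ring

lemma Gamma_add_natCast {a : ℂ} (ha : 0 < a.re) (k : ℕ) :
    Complex.Gamma (a + k) = poch a k * Complex.Gamma a := by
  induction k with
  | zero => simp [poch]
  | succ k ih =>
    have : a + k ≠ 0 := fun h ↦ by
      have := congr_arg Complex.re h
      simp at this
      have : (0 : ℝ) ≤ k := k.cast_nonneg
      linarith
    rw [Nat.cast_succ, ← add_assoc, Complex.Gamma_add_one _ this, ih, poch, poch,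
      prod_range_succ]
    ring

/-- The weight `e^{-Y} Y^ρ`. -/
noncomputable def gammaWeight (ρ Y : ℝ) : ℂ := Complex.exp (-(Y : ℂ)) * (Y : ℂ) ^ (ρ : ℂ)

lemma gammaWeight_mul_pow {ρ Y : ℝ} (hY : 0 < Y) (k : ℕ) :
    gammaWeight ρ Y * (Y : ℂ) ^ k =
      ((Real.exp (-Y) : ℝ) : ℂ) * (Y : ℂ) ^ ((ρ : ℂ) + 1 + k - 1) := by
  have : (Y : ℂ) ≠ 0 := by exact_mod_cast hY.ne'
  rw [show (ρ : ℂ) + 1 + k - 1 = ρ + k by ring, Complex.cpow_add _ _ this, Complex.cpow_natCast,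
    gammaWeight]
  push_cast
  ring

lemma integrableOn_gammaWeight_mul_pow {ρ : ℝ} (hρ : -1 < ρ) (k : ℕ) :
    IntegrableOn (fun Y : ℝ ↦ gammaWeight ρ Y * (Y : ℂ) ^ k) (Set.Ioi 0) := by
  refine (Complex.GammaIntegral_convergent (s := (ρ : ℂ) + 1 + k) ?_).congr_fun
    (fun Y hY ↦ (gammaWeight_mul_pow hY k).symm) measurableSet_Ioi
  have : (0 : ℝ) ≤ k := k.cast_nonneg
  simp
  linarith

lemma integral_gammaWeight_mul_pow {ρ : ℝ} (hρ : -1 < ρ) (k : ℕ) :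
    ∫ Y in Set.Ioi (0 : ℝ), gammaWeight ρ Y * (Y : ℂ) ^ k =
      Complex.Gamma ((ρ : ℂ) + 1 + k) := by
  rw [Complex.Gamma_eq_integral, Complex.GammaIntegral]
  · exact setIntegral_congr_fun measurableSet_Ioi fun Y hY ↦ gammaWeight_mul_pow hY k
  · have : (0 : ℝ) ≤ k := k.cast_nonneg
    simp
    linarith

lemma gammaWeight_mul_pow_mul_konhauserY (ρ : ℝ) (Υ m k : ℕ) (Y : ℝ) :
    gammaWeight ρ Y * (Y : ℂ) ^ k * konhauserY ρ Υ m Y =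
      ∑ i ∈ range (m + 1), (1 / (m.factorial : ℂ) / (i.factorial : ℂ) *
        ∑ j ∈ range (i + 1), (-1) ^ j * (i.choose j : ℂ) * poch (((j : ℂ) + ρ + 1) / Υ) m) *
          (gammaWeight ρ Y * (Y : ℂ) ^ (k + i)) := by
  rw [konhauserY, mul_sum, mul_sum]
  refine sum_congr rfl fun i _ ↦ ?_
  rw [pow_add]
  ring

lemma integrableOn_gammaWeight_mul_pow_mul_konhauserY {ρ : ℝ} (hρ : -1 < ρ) (Υ m k : ℕ) :
    IntegrableOn (fun Y : ℝ ↦ gammaWeight ρ Y * (Y : ℂ) ^ k * konhauserY ρ Υ m Y)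
      (Set.Ioi 0) := by
  simp only [gammaWeight_mul_pow_mul_konhauserY]
  exact integrable_finsetSum _ fun i _ ↦ (integrableOn_gammaWeight_mul_pow hρ _).const_mul _

lemma integral_gammaWeight_mul_pow_mul_konhauserY {ρ : ℝ} (hρ : -1 < ρ) {Υ : ℕ} (hΥ : 0 < Υ)
    (m r : ℕ) :
    ∫ Y in Set.Ioi (0 : ℝ), gammaWeight ρ Y * (Y : ℂ) ^ (Υ * r) * konhauserY ρ Υ m Y =
      Complex.Gamma ((ρ : ℂ) + 1 + (Υ : ℂ) * r) * ((-1) ^ m * (r.choose m : ℂ)) := by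
  have hΥ' : (Υ : ℂ) ≠ 0 := by exact_mod_cast hΥ.ne'
  have hm : (m.factorial : ℂ) ≠ 0 := by exact_mod_cast m.factorial_ne_zero
  simp only [gammaWeight_mul_pow_mul_konhauserY]
  rw [integral_finsetSum _ fun i _ ↦ (integrableOn_gammaWeight_mul_pow hρ _).const_mul _]
  simp only [integral_const_mul, integral_gammaWeight_mul_pow hρ]
  set a : ℂ := (ρ : ℂ) + 1 + (Υ : ℂ) * r with ha
  have ha' : 0 < a.re := by
    have : (0 : ℝ) ≤ Υ * r := by positivity
    simp [ha]
    linarith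
  let p : ℂ[X] := (ascPochhammer ℂ m).comp (C (1 / (Υ : ℂ)) * X + C (((ρ : ℂ) + 1) / Υ))
  have hp : p.natDegree ≤ m := by
    refine natDegree_comp_le.trans ?_
    rw [ascPochhammer_natDegree]
    exact (Nat.mul_le_mul_left m natDegree_linear_le).trans_eq (mul_one m)
  have hpe (x : ℂ) : p.eval x = poch ((x + ρ + 1) / Υ) m := by
    rw [poch_eq_ascPochhammer_eval, eval_comp]
    congr 1
    simp
    ring
  have key := sum_poch_mul_sum_choose p hp a
  simp only [hpe] at key
  rw [show (-a + ρ + 1) / Υ = -(r : ℂ) by rw [ha]; field_simp; ring, poch_neg_natCast,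
    Nat.descFactorial_eq_factorial_mul_choose] at key
  push_cast at key
  have : (-1) ^ m * (r.choose m : ℂ) = (1 / (m.factorial : ℂ)) *
      ((-1) ^ m * ((m.factorial : ℂ) * (r.choose m : ℂ))) := by field_simp
  rw [this, ← key, mul_sum, mul_sum]
  refine sum_congr rfl fun i _ ↦ ?_
  rw [show (ρ : ℂ) + 1 + ((Υ * r + i : ℕ) : ℂ) = a + i by rw [ha]; push_cast; ring,
    Gamma_add_natCast ha']
  ring

/-- The Konhauser polynomial `Z_k^ρ(Y;Υ)`, normalised so that its biorthogonality constant with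
`konhauserY` is `1`. -/
noncomputable def konhauserZNormalized (ρ : ℝ) (Υ k : ℕ) (Y : ℂ) : ℂ :=
  ∑ r ∈ range (k + 1), poch (-(k : ℂ)) r /
    (Complex.Gamma ((ρ : ℂ) + 1 + (Υ : ℂ) * r) * (r.factorial : ℂ)) * Y ^ (Υ * r)

lemma gammaWeight_mul_konhauserZNormalized_mul_konhauserY (ρ : ℝ) (Υ k m : ℕ) (Y : ℝ) :
    gammaWeight ρ Y * konhauserZNormalized ρ Υ k Y * konhauserY ρ Υ m Y =
      ∑ r ∈ range (k + 1), poch (-(k : ℂ)) r /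
        (Complex.Gamma ((ρ : ℂ) + 1 + (Υ : ℂ) * r) * (r.factorial : ℂ)) *
          (gammaWeight ρ Y * (Y : ℂ) ^ (Υ * r) * konhauserY ρ Υ m Y) := by
  rw [konhauserZNormalized, mul_sum, sum_mul]
  refine sum_congr rfl fun r _ ↦ ?_
  ring

lemma integrableOn_gammaWeight_mul_konhauserZNormalized_mul_konhauserY {ρ : ℝ} (hρ : -1 < ρ)
    (Υ k m : ℕ) :
    IntegrableOn (fun Y : ℝ ↦ gammaWeight ρ Y * konhauserZNormalized ρ Υ k Y * konhauserY ρ Υ m Y)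
      (Set.Ioi 0) := by
  simp only [gammaWeight_mul_konhauserZNormalized_mul_konhauserY]
  exact integrable_finsetSum _ fun i _ ↦
    (integrableOn_gammaWeight_mul_pow_mul_konhauserY hρ _ _ _).const_mul _

lemma integral_gammaWeight_mul_konhauserZNormalized_mul_konhauserY {ρ : ℝ} (hρ : -1 < ρ) {Υ : ℕ}
    (hΥ : 0 < Υ) (k m : ℕ) :
    ∫ Y in Set.Ioi (0 : ℝ), gammaWeight ρ Y * konhauserZNormalized ρ Υ k Y * konhauserY ρ Υ m Y =
      if k = m then 1 else 0 := by
  simp only [gammaWeight_mul_konhauserZNormalized_mul_konhauserY]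
  rw [integral_finsetSum _ fun i _ ↦
    (integrableOn_gammaWeight_mul_pow_mul_konhauserY hρ _ _ _).const_mul _]
  simp only [integral_const_mul, integral_gammaWeight_mul_pow_mul_konhauserY hρ hΥ]
  have h := fwdDiff_iter_choose_zero m k
  rw [fwdDiff_iter_eq_sum_shift] at h
  have h' : ∑ r ∈ range (k + 1), (-1 : ℂ) ^ (k - r) * (k.choose r : ℂ) * (r.choose m : ℂ) =
      if k = m then 1 else 0 := by
    have := congr_arg (Int.cast : ℤ → ℂ) h
    simpa using this
  have hsq (i : ℕ) : ((-1 : ℂ) ^ i) * (-1) ^ i = 1 := by rw [← mul_pow]; simp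
  trans (-1) ^ (k + m) * (if k = m then 1 else 0 : ℂ)
  · rw [← h', mul_sum]
    refine sum_congr rfl fun r hr ↦ ?_
    obtain ⟨t, rfl⟩ := Nat.exists_eq_add_of_le (mem_range_succ_iff.mp hr)
    have h1 : (r.factorial : ℂ) ≠ 0 := by exact_mod_cast r.factorial_ne_zero
    have h2 : Complex.Gamma ((ρ : ℂ) + 1 + (Υ : ℂ) * r) ≠ 0 := by
      refine Complex.Gamma_ne_zero_of_re_pos ?_
      have : (0 : ℝ) ≤ Υ * r := by positivity
      simp
      linarith
    rw [poch_neg_natCast, Nat.descFactorial_eq_factorial_mul_choose, Nat.add_sub_cancel_left]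
    push_cast
    rw [pow_add, pow_add]
    field_simp
    linear_combination (-((r + t).choose r : ℂ) * (r.choose m : ℂ)) * hsq t
  · split_ifs with hkm
    · rw [hkm, pow_add, hsq, mul_one]
    · simp

/-- The physicists' Hermite polynomial as a formal polynomial. -/
noncomputable def hermitePolynomial (m : ℕ) : ℂ[X] :=
  ∑ s ∈ range (m / 2 + 1),
    C ((-1) ^ s * (m.descFactorial (2 * s) : ℂ) / (s.factorial : ℂ)) * (C 2 * X) ^ (m - 2 * s)

lemma eval_hermitePolynomial (m : ℕ) (x : ℂ) : (hermitePolynomial m).eval x = hermitePoly m x := by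
  simp [hermitePolynomial, hermitePoly, eval_finsetSum, poch_neg_natCast]

lemma hermitePolynomial_eq_sum_range {m N : ℕ} (h : m / 2 + 1 ≤ N) :
    hermitePolynomial m = ∑ s ∈ range N,
      C ((-1) ^ s * (m.descFactorial (2 * s) : ℂ) / (s.factorial : ℂ)) *
        (C 2 * X) ^ (m - 2 * s) := by
  refine sum_subset (range_mono h) fun s _ hs ↦ ?_
  rw [Nat.descFactorial_of_lt (by simp at hs; lia)]
  simp

lemma succ_descFactorial_eq_add (m k : ℕ) :
    (m + 1).descFactorial (k + 1) = m.descFactorial (k + 1) + (k + 1) * m.descFactorial k := by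
  rw [Nat.succ_descFactorial_succ, Nat.descFactorial_succ]
  rcases le_or_gt k m with h | h
  · obtain ⟨t, rfl⟩ := Nat.exists_eq_add_of_le h
    rw [Nat.add_sub_cancel_left]
    ring
  · simp [Nat.descFactorial_of_lt h]

lemma hermitePolynomial_coeff_succ (m s : ℕ) :
    (-1) ^ (s + 1) * ((m + 1).descFactorial (2 * (s + 1)) : ℂ) / ((s + 1).factorial : ℂ) =
      (-1) ^ (s + 1) * (m.descFactorial (2 * (s + 1)) : ℂ) / ((s + 1).factorial : ℂ) -
        2 * ((m - 2 * s : ℕ) : ℂ) * ((-1) ^ s * (m.descFactorial (2 * s) : ℂ) /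
          (s.factorial : ℂ)) := by
  have h1 : (s.factorial : ℂ) ≠ 0 := by exact_mod_cast s.factorial_ne_zero
  have h2 : (s : ℂ) + 1 ≠ 0 := by exact_mod_cast s.succ_ne_zero
  rw [show 2 * (s + 1) = 2 * s + 1 + 1 by ring, succ_descFactorial_eq_add,
    Nat.descFactorial_succ m (2 * s), Nat.factorial_succ]
  push_cast
  field_simp
  ring

lemma hermitePolynomial_succ (m : ℕ) :
    hermitePolynomial (m + 1) =
      C 2 * X * hermitePolynomial m - derivative (hermitePolynomial m) := by
  rw [hermitePolynomial_eq_sum_range (m := m + 1) (N := m + 1 + 1) (by lia), sum_range_succ']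
  have h := hermitePolynomial_eq_sum_range (m := m) (N := m + 1 + 1) (by lia)
  rw [sum_range_succ'] at h
  nth_rw 1 [h]
  rw [hermitePolynomial_eq_sum_range (m := m) (N := m + 1) (by lia), derivative_sum, mul_add,
    mul_sum, add_sub_right_comm, ← sum_sub_distrib]
  congr 1
  · refine sum_congr rfl fun s _ ↦ ?_
    rw [hermitePolynomial_coeff_succ, derivative_C_mul, derivative_pow, derivative_C_mul_X,
      show m + 1 - 2 * (s + 1) = m - 2 * s - 1 by lia]
    rcases le_or_gt (2 * (s + 1)) m with h | h
    · rw [show m - 2 * s - 1 = m - 2 * (s + 1) + 1 by lia]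
      simp only [C_sub, C_mul]
      ring
    · rw [Nat.descFactorial_of_lt h]
      simp only [C_sub, C_mul, Nat.cast_zero, mul_zero, zero_div, C_0]
      ring
  · simp [pow_succ]
    ring

/-- Integration of a polynomial against the weight `e^{-x²}`. -/
noncomputable def gaussianIntegral (p : ℂ[X]) : ℂ :=
  ∫ x : ℝ, Complex.exp (-(x : ℂ) ^ 2) * p.eval (x : ℂ)

lemma integrable_gaussian_mul_eval (p : ℂ[X]) :
    Integrable fun x : ℝ ↦ Complex.exp (-(x : ℂ) ^ 2) * p.eval (x : ℂ) := by
  induction p using Polynomial.induction_on' with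
  | add p q hp hq => simpa [mul_add, Pi.add_def] using hp.add hq
  | monomial k c =>
    have h := (integrable_rpow_mul_exp_neg_mul_sq (b := 1) one_pos (s := k)
      (by have : (0 : ℝ) ≤ k := k.cast_nonneg
          linarith)).ofReal (𝕜 := ℂ)
    refine (h.const_mul c).congr (.of_forall fun x ↦ ?_)
    simp
    ring

lemma gaussianIntegral_sub (p q : ℂ[X]) :
    gaussianIntegral (p - q) = gaussianIntegral p - gaussianIntegral q := by
  simp only [gaussianIntegral, eval_sub, mul_sub]
  exact integral_sub (integrable_gaussian_mul_eval p) (integrable_gaussian_mul_eval q)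

lemma gaussianIntegral_C_mul (c : ℂ) (p : ℂ[X]) :
    gaussianIntegral (C c * p) = c * gaussianIntegral p := by
  simp only [gaussianIntegral, eval_mul, eval_C, ← integral_const_mul]
  congr 1 with x
  ring

lemma gaussianIntegral_one : gaussianIntegral 1 = (Real.sqrt Real.pi : ℂ) := by
  have h := integral_gaussian 1
  rw [div_one] at h
  rw [← h, ← integral_complex_ofReal, gaussianIntegral]
  simp

lemma gaussianIntegral_derivative (p : ℂ[X]) :
    gaussianIntegral (derivative p) = gaussianIntegral (C 2 * X * p) := by
  rw [← sub_eq_zero, ← gaussianIntegral_sub]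
  refine integral_eq_zero_of_hasDerivAt_of_integrable
    (f := fun x : ℝ ↦ Complex.exp (-(x : ℂ) ^ 2) * p.eval (x : ℂ)) (fun x ↦ ?_)
    (integrable_gaussian_mul_eval _) (integrable_gaussian_mul_eval p)
  have h1 : HasDerivAt (fun z : ℂ ↦ Complex.exp (-z ^ 2))
      (Complex.exp (-(x : ℂ) ^ 2) * (-(2 * x))) (x : ℂ) := by
    simpa using ((hasDerivAt_pow 2 (x : ℂ)).neg).cexp
  refine ((h1.mul (p.hasDerivAt (x : ℂ))).comp_ofReal).congr_deriv ?_
  simp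
  ring

lemma gaussianIntegral_hermitePolynomial_mul (m : ℕ) (q : ℂ[X]) :
    gaussianIntegral (hermitePolynomial m * q) = gaussianIntegral (derivative^[m] q) := by
  induction m generalizing q with
  | zero => simp [hermitePolynomial]
  | succ m ih =>
    rw [Function.iterate_succ_apply, ← ih, hermitePolynomial_succ, sub_mul, mul_assoc,
      gaussianIntegral_sub, ← gaussianIntegral_derivative, derivative_mul, ← gaussianIntegral_sub]
    congr 1
    ring

lemma gaussianIntegral_hermitePolynomial_mul_pow {m k : ℕ} (h : k ≤ m) :
    gaussianIntegral (hermitePolynomial m * (C 2 * X) ^ k) =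
      if k = m then 2 ^ m * (m.factorial : ℂ) * (Real.sqrt Real.pi : ℂ) else 0 := by
  rw [gaussianIntegral_hermitePolynomial_mul, mul_pow, ← C_pow, iterate_derivative_C_mul,
    gaussianIntegral_C_mul, iterate_derivative_X_pow_eq_C_mul, gaussianIntegral_C_mul]
  split_ifs with hk
  · subst hk
    simp [gaussianIntegral_one, Nat.descFactorial_self, mul_assoc]
  · rw [Nat.descFactorial_of_lt (by lia)]
    simp

lemma hermiteKonhauser_eq_sum (ρ : ℝ) (Υ n : ℕ) (X Y : ℂ) :
    hermiteKonhauser ρ Υ n X Y = ∑ s ∈ range (n / 2 + 1),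
      (-1) ^ s * poch (-(n : ℂ)) (2 * s) / (s.factorial : ℂ) * (2 * X) ^ (n - 2 * s) *
        konhauserZNormalized ρ Υ (n - s) Y := by
  refine sum_congr rfl fun s hs ↦ ?_
  have hsn : s ≤ n := by simp at hs; lia
  rw [konhauserZNormalized, mul_sum]
  refine sum_congr rfl fun r _ ↦ ?_
  have h0 := poch_neg_natCast_ne_zero hsn
  rw [poch_add, show -(n : ℂ) + s = -((n - s : ℕ) : ℂ) by push_cast [hsn]; ring]
  field_simp

/-- Biorthogonality of the 2D Hermite–Konhauser polynomials:
`∫_0^∞ ∫_{-∞}^∞ e^{-X²-Y} Y^ρ ₖH_n^ρ(X,Y) Q_m(X,Y) dX dY = 2^n n! √π δ_{nm}`. -/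
theorem hermiteKonhauser_biorthogonal (ρ : ℝ) (hρ : -1 < ρ) (Υ : ℕ) (hΥ : 0 < Υ)
    (n m : ℕ) :
    (∫ Y in Set.Ioi (0 : ℝ), ∫ X : ℝ,
        Complex.exp (-(X : ℂ) ^ 2 - (Y : ℂ)) * (Y : ℂ) ^ (ρ : ℂ) *
          hermiteKonhauser ρ Υ n (X : ℂ) (Y : ℂ) * hermiteKonhauserQ ρ Υ m (X : ℂ) (Y : ℂ)) =
      if n = m then 2 ^ n * (n.factorial : ℂ) * (Real.sqrt Real.pi : ℂ) else 0 := by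
  let g (s : ℕ) (Y : ℝ) : ℂ := gammaWeight ρ Y * konhauserZNormalized ρ Υ (n - s) Y *
    ∑ j ∈ range (m + 1), konhauserY ρ Υ j Y
  let c (s : ℕ) : ℂ := (-1) ^ s * poch (-(n : ℂ)) (2 * s) / (s.factorial : ℂ)
  have hg (s : ℕ) (Y : ℝ) : g s Y = ∑ j ∈ range (m + 1),
      gammaWeight ρ Y * konhauserZNormalized ρ Υ (n - s) Y * konhauserY ρ Υ j Y := mul_sum ..
  have hg_integrable (s : ℕ) : IntegrableOn (g s) (Set.Ioi 0) := by
    simp only [funext (hg s)]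
    exact integrable_finsetSum _ fun j _ ↦
      integrableOn_gammaWeight_mul_konhauserZNormalized_mul_konhauserY hρ Υ _ j
  have hg_integral (s : ℕ) : ∫ Y in Set.Ioi (0 : ℝ), g s Y = if n - s ≤ m then 1 else 0 := by
    simp only [hg]
    rw [integral_finsetSum _ fun j _ ↦
      integrableOn_gammaWeight_mul_konhauserZNormalized_mul_konhauserY hρ Υ _ j]
    simp only [integral_gammaWeight_mul_konhauserZNormalized_mul_konhauserY hρ hΥ, sum_ite_eq,
      mem_range, Nat.lt_succ_iff]
  have hinner (Y : ℝ) : ∫ X : ℝ, Complex.exp (-(X : ℂ) ^ 2 - (Y : ℂ)) * (Y : ℂ) ^ (ρ : ℂ) *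
        hermiteKonhauser ρ Υ n (X : ℂ) (Y : ℂ) * hermiteKonhauserQ ρ Υ m (X : ℂ) (Y : ℂ) =
      ∑ s ∈ range (n / 2 + 1), c s *
        gaussianIntegral (hermitePolynomial m * (C 2 * X) ^ (n - 2 * s)) * g s Y := by
    simp only [gaussianIntegral, ← integral_const_mul, ← integral_mul_const]
    rw [← integral_finsetSum _ fun s _ ↦
      ((integrable_gaussian_mul_eval _).const_mul _).mul_const _]
    congr 1 with x
    rw [hermiteKonhauser_eq_sum, mul_sum, sum_mul]
    refine sum_congr rfl fun s _ ↦ ?_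
    simp only [hermiteKonhauserQ, g, c, gammaWeight, eval_mul, eval_hermitePolynomial, eval_pow,
      eval_C, eval_X, sub_eq_add_neg, Complex.exp_add]
    ring
  simp only [hinner]
  rw [integral_finsetSum _ fun s _ ↦ (hg_integrable s).const_mul _]
  simp only [integral_const_mul, hg_integral]
  have hterm (s : ℕ) (hsn : s ∈ range (n / 2 + 1)) (hs : ¬(s = 0 ∧ n = m)) : c s *
      gaussianIntegral (hermitePolynomial m * (C 2 * X) ^ (n - 2 * s)) *
        (if n - s ≤ m then 1 else 0 : ℂ) = 0 := by
    split_ifs with h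
    · rw [mem_range] at hsn
      rw [gaussianIntegral_hermitePolynomial_mul_pow (by lia), if_neg (by lia)]
      simp
    · simp
  split_ifs with hnm
  · subst hnm
    rw [sum_eq_single 0 (fun s hsn hs ↦ hterm s hsn (by simp [hs])) (by simp)]
    simp [c, poch, gaussianIntegral_hermitePolynomial_mul_pow]
  · exact sum_eq_zero fun s hsn ↦ hterm s hsn (by simp [hnm])
end

section
/- The fractional-derivative image: for Re(ρ) > Re(μ) ≥ 0, the Riemann–Liouville fractional derivative of order μ in Y with base point B applied to (Y−B)^{ρ−1} E_{ρ,Υ}^{(γ₁;γ₂;γ₃)}(X, w(Y−B)) equals (Y−B)^{ρ−μ−1} E_{ρ−μ,Υ}^{(γ₁;γ₂;γ₃)}(X, w(Y−B)) for Y > B. -/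
open MeasureTheory

/-- The bivariate Hermite–Konhauser Mittag-Leffler function
`E_{ρ,Υ}^{(γ₁;γ₂;γ₃)}(X,Y)`. -/
noncomputable def mlE3 (ρ : ℂ) (Υ : ℕ) (γ1 γ2 γ3 X Y : ℂ) : ℂ :=
  ∑' s : ℕ, ∑' r : ℕ,
    poch γ1 (2 * s) * poch γ2 (s + r) * X ^ s * Y ^ (Υ * r) /
      (poch γ3 s * Complex.Gamma (ρ + (Υ : ℂ) * r) * (r.factorial : ℂ) * (s.factorial : ℂ))

/-- The Riemann–Liouville fractional derivative of order `μ` with base point `B`: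
`D^μ_{B+} f = (d/dY)^n (I^{n-μ}_{B+} f)` with `n = ⌊Re μ⌋ + 1`. -/
noncomputable def rlDeriv (μ : ℂ) (B : ℝ) (f : ℝ → ℂ) (Y : ℝ) : ℂ :=
  (deriv^[⌊μ.re⌋.toNat + 1] fun y : ℝ =>
    (1 / Complex.Gamma ((⌊μ.re⌋.toNat + 1 : ℕ) - μ)) *
      ∫ t in B..y, ((y - t : ℝ) : ℂ) ^ (((⌊μ.re⌋.toNat + 1 : ℕ) : ℂ) - μ - 1) * f t) Y

/-- The series `∑ A i * z ^ k i / Γ(α + k i)`. -/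
noncomputable def gammaSeries {ι : Type*} (A : ι → ℂ) (k : ι → ℕ) (α z : ℂ) : ℂ :=
  ∑' i, A i * z ^ k i / Complex.Gamma (α + k i)

/-- The series `∑ A i * z ^ k i / Γ(α + k i)` converges absolutely for every `z`. -/
def GammaSummable {ι : Type*} (A : ι → ℂ) (k : ι → ℕ) (α : ℂ) : Prop :=
  ∀ z : ℂ, Summable fun i => A i * z ^ k i / Complex.Gamma (α + k i)

lemma Complex.Gamma_add_natCast_ne_zero {α : ℂ} (hα : 0 < α.re) (m : ℕ) :
    Complex.Gamma (α + m) ≠ 0 := by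
  apply Complex.Gamma_ne_zero_of_re_pos
  simp only [Complex.add_re, Complex.natCast_re]
  positivity

lemma Complex.add_natCast_ne_zero {α : ℂ} (hα : 0 < α.re) (m : ℕ) : α + m ≠ 0 := by
  intro h
  have h' := congrArg Complex.re h
  simp only [Complex.add_re, Complex.natCast_re, Complex.zero_re] at h'
  have : (0 : ℝ) ≤ m := by positivity
  linarith

lemma Complex.betaIntegral_add_natCast (ρ β : ℂ) (m : ℕ) :
    Complex.betaIntegral (ρ + m) β =
      ∫ u : ℝ in 0..1, (u : ℂ) ^ (ρ - 1) * (1 - (u : ℂ)) ^ (β - 1) * (u : ℂ) ^ m := by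
  rw [Complex.betaIntegral, intervalIntegral.integral_of_le zero_le_one,
    intervalIntegral.integral_of_le zero_le_one]
  refine setIntegral_congr_fun measurableSet_Ioc fun u hu => ?_
  have hu0 : (u : ℂ) ≠ 0 := Complex.ofReal_ne_zero.mpr hu.1.ne'
  rw [show ρ + m - 1 = (ρ - 1) + m by ring, Complex.cpow_add _ _ hu0, Complex.cpow_natCast]
  ring

lemma Complex.betaIntegral_add_natCast_div_Gamma {ρ β : ℂ} (hρ : 0 < ρ.re) (hβ : 0 < β.re)
    (m : ℕ) :
    Complex.betaIntegral (ρ + m) β / Complex.Gamma (ρ + m) =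
      Complex.Gamma β / Complex.Gamma (ρ + β + m) := by
  have hρm : 0 < (ρ + m).re := by
    simp only [Complex.add_re, Complex.natCast_re]; positivity
  have h := Complex.Gamma_mul_Gamma_eq_betaIntegral hρm hβ
  rw [div_eq_div_iff (Complex.Gamma_add_natCast_ne_zero hρ m)
    (Complex.Gamma_add_natCast_ne_zero (by simpa using add_pos hρ hβ) m),
    mul_comm (Complex.Gamma β), h, show ρ + m + β = ρ + β + m by ring, mul_comm]

lemma Complex.exists_norm_betaIntegral_add_natCast_le {ρ β : ℂ} (hρ : 0 < ρ.re)
    (hβ : 0 < β.re) : ∃ C : ℝ, ∀ m : ℕ, ‖Complex.betaIntegral (ρ + m) β‖ ≤ C := by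
  refine ⟨∫ u : ℝ in 0..1, ‖(u : ℂ) ^ (ρ - 1) * (1 - (u : ℂ)) ^ (β - 1)‖, fun m => ?_⟩
  rw [Complex.betaIntegral_add_natCast]
  refine intervalIntegral.norm_integral_le_of_norm_le zero_le_one
    (.of_forall fun u hu => ?_) (Complex.betaIntegral_convergent hρ hβ).norm
  rw [norm_mul, norm_pow, Complex.norm_real, Real.norm_of_nonneg hu.1.le]
  exact mul_le_of_le_one_right (norm_nonneg _) (pow_le_one₀ hu.1.le hu.2)

section GammaSeries

variable {ι : Type*} {A : ι → ℂ} {k : ι → ℕ} {α β ρ : ℂ}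

lemma GammaSummable.add (h : GammaSummable A k ρ) (hρ : 0 < ρ.re) (hβ : 0 < β.re) :
    GammaSummable A k (ρ + β) := by
  obtain ⟨C, hC⟩ := Complex.exists_norm_betaIntegral_add_natCast_le hρ hβ
  have hΓ := Complex.Gamma_ne_zero_of_re_pos hβ
  intro z
  refine Summable.of_norm_bounded ((h z).norm.mul_left (C / ‖Complex.Gamma β‖)) fun i => ?_
  have key : A i * z ^ k i / Complex.Gamma (ρ + β + k i) =
      Complex.betaIntegral (ρ + k i) β / Complex.Gamma β *
        (A i * z ^ k i / Complex.Gamma (ρ + k i)) := by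
    calc _ = A i * z ^ k i / Complex.Gamma β *
          (Complex.Gamma β / Complex.Gamma (ρ + β + k i)) := by field_simp
      _ = _ := by
        rw [← Complex.betaIntegral_add_natCast_div_Gamma hρ hβ]; ring
  rw [key, norm_mul, norm_div]
  gcongr
  exact hC _

lemma GammaSummable.of_add_one (h : GammaSummable A k (α + 1)) (hα : 0 < α.re) :
    GammaSummable A k α := by
  intro z
  refine Summable.of_norm_bounded ((h (2 * z)).norm.mul_left (‖α‖ + 1)) fun i => ?_
  have h0 := Complex.add_natCast_ne_zero hα (k i)
  have hΓ := Complex.Gamma_add_natCast_ne_zero hα (k i)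
  have hle : ‖α + k i‖ ≤ (‖α‖ + 1) * 2 ^ k i := by
    have h1 : (k i : ℝ) ≤ 2 ^ k i := by exact_mod_cast Nat.lt_two_pow_self.le
    have h2 : (1 : ℝ) ≤ 2 ^ k i := one_le_pow₀ one_le_two
    calc ‖α + k i‖ ≤ ‖α‖ + k i := by simpa using norm_add_le α (k i : ℂ)
      _ ≤ ‖α‖ * 2 ^ k i + 2 ^ k i := by
        gcongr
        exact le_mul_of_one_le_right (norm_nonneg _) h2
      _ = _ := by ring
  have key : A i * z ^ k i / Complex.Gamma (α + k i) =
      (α + k i) * (A i * z ^ k i / Complex.Gamma (α + 1 + k i)) := by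
    rw [show α + 1 + k i = α + k i + 1 by ring, Complex.Gamma_add_one _ h0]
    field_simp
  calc _ = ‖α + k i‖ * ‖A i * z ^ k i / Complex.Gamma (α + 1 + k i)‖ := by rw [key, norm_mul]
    _ ≤ (‖α‖ + 1) * 2 ^ k i * ‖A i * z ^ k i / Complex.Gamma (α + 1 + k i)‖ := by gcongr
    _ = _ := by
      simp only [norm_mul, norm_div, norm_pow, mul_pow, Complex.norm_ofNat]
      ring

lemma integral_beta_mul_gammaSeries [Countable ι] (h : GammaSummable A k ρ) (hρ : 0 < ρ.re)
    (hβ : 0 < β.re) (z : ℂ) :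
    ∫ u : ℝ in 0..1, (u : ℂ) ^ (ρ - 1) * (1 - (u : ℂ)) ^ (β - 1) * gammaSeries A k ρ (z * u) =
      Complex.Gamma β * gammaSeries A k (ρ + β) z := by
  have hint := Complex.betaIntegral_convergent hρ hβ
  have hsum := intervalIntegral.hasSum_integral_of_dominated_convergence
    (μ := volume) (a := 0) (b := 1)
    (F := fun i (u : ℝ) => (u : ℂ) ^ (ρ - 1) * (1 - (u : ℂ)) ^ (β - 1) *
      (A i * (z * u) ^ k i / Complex.Gamma (ρ + k i)))
    (f := fun u : ℝ => (u : ℂ) ^ (ρ - 1) * (1 - (u : ℂ)) ^ (β - 1) *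
      gammaSeries A k ρ (z * u))
    (fun i u => ‖(u : ℂ) ^ (ρ - 1) * (1 - (u : ℂ)) ^ (β - 1)‖ *
      ‖A i * z ^ k i / Complex.Gamma (ρ + k i)‖)
    (fun i => by
      refine (intervalIntegrable_iff.mp hint).aestronglyMeasurable.mul ?_
      exact Continuous.aestronglyMeasurable (by fun_prop))
    (fun i => .of_forall fun u hu => by
      rw [Set.uIoc_of_le zero_le_one] at hu
      simp only [norm_mul, norm_div, norm_pow, Complex.norm_real, Real.norm_of_nonneg hu.1.le]
      gcongr
      · exact mul_nonneg (norm_nonneg z) hu.1.le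
      · exact mul_le_of_le_one_right (norm_nonneg z) hu.2)
    (.of_forall fun u _ => (h z).norm.mul_left _)
    (by
      simp only [tsum_mul_left]
      exact hint.norm.mul_const _)
    (.of_forall fun u _ => (h (z * u)).hasSum.mul_left _)
  rw [← hsum.tsum_eq, gammaSeries, ← tsum_mul_left]
  refine tsum_congr fun i => ?_
  calc _ = ∫ u : ℝ in 0..1, (A i * z ^ k i / Complex.Gamma (ρ + k i)) *
        ((u : ℂ) ^ (ρ - 1) * (1 - (u : ℂ)) ^ (β - 1) * (u : ℂ) ^ k i) := by
        congr 1; ext u; ring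
    _ = A i * z ^ k i *
        (Complex.betaIntegral (ρ + k i) β / Complex.Gamma (ρ + k i)) := by
        rw [intervalIntegral.integral_const_mul, ← Complex.betaIntegral_add_natCast]; ring
    _ = _ := by rw [Complex.betaIntegral_add_natCast_div_Gamma hρ hβ]; ring

lemma integral_rlKernel_mul_gammaSeries [Countable ι] (h : GammaSummable A k ρ) (hρ : 0 < ρ.re)
    (hβ : 0 < β.re) (w : ℂ) {B y : ℝ} (hy : B < y) :
    ∫ t in B..y, ((y - t : ℝ) : ℂ) ^ (β - 1) *
        (((t - B : ℝ) : ℂ) ^ (ρ - 1) * gammaSeries A k ρ (w * ((t : ℂ) - B))) =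
      Complex.Gamma β * (((y - B : ℝ) : ℂ) ^ (ρ + β - 1) *
        gammaSeries A k (ρ + β) (w * ((y : ℂ) - B))) := by
  have hD : 0 < y - B := sub_pos.mpr hy
  have hD0 : ((y - B : ℝ) : ℂ) ≠ 0 := Complex.ofReal_ne_zero.mpr hD.ne'
  have hsub := intervalIntegral.smul_integral_comp_mul_add (a := 0) (b := 1)
    (f := fun t : ℝ => ((y - t : ℝ) : ℂ) ^ (β - 1) *
      (((t - B : ℝ) : ℂ) ^ (ρ - 1) * gammaSeries A k ρ (w * ((t : ℂ) - B)))) (y - B) B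
  simp only [mul_zero, zero_add, mul_one, sub_add_cancel] at hsub
  rw [← hsub]
  have hcongr : ∫ u : ℝ in 0..1, ((y - ((y - B) * u + B) : ℝ) : ℂ) ^ (β - 1) *
      ((((y - B) * u + B - B : ℝ) : ℂ) ^ (ρ - 1) *
        gammaSeries A k ρ (w * ((((y - B) * u + B : ℝ) : ℂ) - B))) =
      ∫ u : ℝ in 0..1, ((y - B : ℝ) : ℂ) ^ (β - 1) * ((y - B : ℝ) : ℂ) ^ (ρ - 1) *
        ((u : ℂ) ^ (ρ - 1) * (1 - (u : ℂ)) ^ (β - 1) *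
          gammaSeries A k ρ (w * ((y : ℂ) - B) * u)) := by
    refine intervalIntegral.integral_congr fun u hu => ?_
    rw [Set.uIcc_of_le zero_le_one] at hu
    rw [show y - ((y - B) * u + B) = (y - B) * (1 - u) by ring,
      show (y - B) * u + B - B = (y - B) * u by ring, Complex.ofReal_mul, Complex.ofReal_mul,
      Complex.mul_cpow_ofReal_nonneg hD.le (sub_nonneg.mpr hu.2),
      Complex.mul_cpow_ofReal_nonneg hD.le hu.1,
      show w * ((((y - B) * u + B : ℝ) : ℂ) - B) = w * ((y : ℂ) - B) * u by push_cast; ring,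
      show (((1 - u : ℝ)) : ℂ) = 1 - (u : ℂ) by push_cast; ring]
    ring
  rw [hcongr, intervalIntegral.integral_const_mul, integral_beta_mul_gammaSeries h hρ hβ,
    Complex.real_smul, show ρ + β - 1 = 1 + (β - 1) + (ρ - 1) by ring,
    Complex.cpow_add _ _ hD0, Complex.cpow_add _ _ hD0, Complex.cpow_one]
  ring

lemma hasDerivAt_cpow_mul_gammaSeries (h : GammaSummable A k (α + 1)) (hα : 0 < α.re)
    (w : ℂ) {B y : ℝ} (hy : B < y) :
    HasDerivAt (fun y : ℝ => ((y - B : ℝ) : ℂ) ^ α *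
        gammaSeries A k (α + 1) (w * ((y : ℂ) - B)))
      (((y - B : ℝ) : ℂ) ^ (α - 1) * gammaSeries A k α (w * ((y : ℂ) - B))) y := by
  have h' := h.of_add_one hα
  obtain ⟨a, ha, hay⟩ := exists_between hy
  have hcont : ContinuousOn (fun x : ℝ => ((x - B : ℝ) : ℂ) ^ (α - 1)) (Set.Icc a (y + 1)) := by
    intro x hx
    refine ContinuousAt.continuousWithinAt ?_
    exact (Complex.continuousAt_ofReal_cpow_const (x - B) (α - 1)
      (Or.inr (sub_pos.mpr (ha.trans_le hx.1)).ne')).comp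
      (f := fun x : ℝ => x - B) (by fun_prop)
  obtain ⟨C, hC⟩ := isCompact_Icc.exists_bound_of_continuousOn hcont
  have hmem : y ∈ Set.Ioo a (y + 1) := ⟨hay, by linarith⟩
  have key := hasDerivAt_tsum_of_isPreconnected
    (g := fun i (x : ℝ) => ((x - B : ℝ) : ℂ) ^ α *
      (A i * (w * ((x : ℂ) - B)) ^ k i / Complex.Gamma (α + 1 + k i)))
    (g' := fun i (x : ℝ) => ((x - B : ℝ) : ℂ) ^ (α - 1) *
      (A i * (w * ((x : ℂ) - B)) ^ k i / Complex.Gamma (α + k i)))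
    (t := Set.Ioo a (y + 1)) (y₀ := y) (y := y)
    ((h' (w * ((y + 1 - B : ℝ) : ℂ))).norm.mul_left C) isOpen_Ioo isPreconnected_Ioo
    ?_ ?_ hmem ((h _).mul_left _) hmem
  · simpa only [gammaSeries, tsum_mul_left] using key
  · intro i x hx
    have hxB : 0 < x - B := sub_pos.mpr (ha.trans hx.1)
    have hxB0 : ((x - B : ℝ) : ℂ) ≠ 0 := Complex.ofReal_ne_zero.mpr hxB.ne'
    have h0 := Complex.add_natCast_ne_zero hα (k i)
    have hd := ((hasDerivAt_ofReal_cpow_const hxB.ne' h0).comp_sub_const x B).const_mul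
      (A i * w ^ k i / Complex.Gamma (α + 1 + k i))
    refine (hd.congr_of_eventuallyEq ?_).congr_deriv ?_
    · filter_upwards [isOpen_Ioo.mem_nhds hx] with v hv
      have hv0 : ((v - B : ℝ) : ℂ) ≠ 0 :=
        Complex.ofReal_ne_zero.mpr (sub_pos.mpr (ha.trans hv.1)).ne'
      rw [Complex.cpow_add _ _ hv0, Complex.cpow_natCast, Complex.ofReal_sub, mul_pow]
      ring
    · have hΓ := Complex.Gamma_add_natCast_ne_zero hα (k i)
      rw [show α + 1 + k i = α + k i + 1 by ring, Complex.Gamma_add_one _ h0,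
        show α + k i - 1 = (α - 1) + k i by ring, Complex.cpow_add _ _ hxB0,
        Complex.cpow_natCast, ← Complex.ofReal_sub, mul_pow]
      field_simp
  · intro i x hx
    have hxB : 0 < x - B := sub_pos.mpr (ha.trans hx.1)
    rw [norm_mul]
    gcongr ?_ * ?_
    · exact (norm_nonneg _).trans (hC y ⟨hay.le, by linarith⟩)
    · exact hC x ⟨hx.1.le, hx.2.le⟩
    · rw [← Complex.ofReal_sub]
      simp only [norm_mul, norm_div, norm_pow, Complex.norm_real, Real.norm_of_nonneg hxB.le,
        Real.norm_of_nonneg (show 0 ≤ y + 1 - B by linarith)]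
      gcongr
      exact hx.2.le

lemma iterate_deriv_cpow_mul_gammaSeries (w : ℂ) {B : ℝ} (hα : 0 < α.re) (n : ℕ) {f : ℝ → ℂ}
    (h : GammaSummable A k (α + n))
    (hf : Set.EqOn f (fun y : ℝ => ((y - B : ℝ) : ℂ) ^ (α + n - 1) *
      gammaSeries A k (α + n) (w * ((y : ℂ) - B))) (Set.Ioi B)) :
    GammaSummable A k α ∧
    Set.EqOn (deriv^[n] f) (fun y : ℝ => ((y - B : ℝ) : ℂ) ^ (α - 1) *
      gammaSeries A k α (w * ((y : ℂ) - B))) (Set.Ioi B) := by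
  induction n generalizing f with
  | zero => simpa using And.intro h hf
  | succ n ih =>
    have hn : 0 < (α + n).re := by
      simp only [Complex.add_re, Complex.natCast_re]; positivity
    rw [Nat.cast_succ, ← add_assoc] at h
    simp only [Nat.cast_succ, ← add_assoc, add_sub_cancel_right] at hf
    rw [Function.iterate_succ_apply]
    refine ih (h.of_add_one hn) fun y hy => ?_
    exact ((hasDerivAt_cpow_mul_gammaSeries h hn w hy).congr_of_eventuallyEq
      (hf.eventuallyEq_of_mem (isOpen_Ioi.mem_nhds hy))).deriv

/-- The Riemann–Liouville derivative of `(t - B) ^ (ρ - 1) * gammaSeries A k ρ (w * (t - B))`. -/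
lemma rlDeriv_cpow_mul_gammaSeries [Countable ι] {μ : ℂ} (h : GammaSummable A k ρ)
    (hμ : 0 ≤ μ.re) (hρμ : μ.re < ρ.re) (w : ℂ) {B Y : ℝ} (hY : B < Y) :
    GammaSummable A k (ρ - μ) ∧
    rlDeriv μ B (fun t : ℝ => ((t - B : ℝ) : ℂ) ^ (ρ - 1) *
        gammaSeries A k ρ (w * ((t : ℂ) - B))) Y =
      ((Y - B : ℝ) : ℂ) ^ (ρ - μ - 1) * gammaSeries A k (ρ - μ) (w * ((Y : ℂ) - B)) := by
  unfold rlDeriv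
  set n := ⌊μ.re⌋.toNat + 1 with hn
  have hρ : 0 < ρ.re := hμ.trans_lt hρμ
  have hβ : 0 < ((n : ℂ) - μ).re := by
    have h1 : ((⌊μ.re⌋.toNat : ℕ) : ℝ) = (⌊μ.re⌋ : ℝ) := by
      exact_mod_cast Int.toNat_of_nonneg (Int.floor_nonneg.mpr hμ)
    have h2 := Int.lt_floor_add_one μ.re
    rw [Complex.sub_re, Complex.natCast_re, hn, Nat.cast_succ, h1]
    linarith
  have hα : 0 < (ρ - μ).re := by simpa using hρμ
  have hΓ := Complex.Gamma_ne_zero_of_re_pos hβ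
  have hadd : ρ + ((n : ℂ) - μ) = ρ - μ + n := by ring
  have hs : GammaSummable A k (ρ - μ + n) := hadd ▸ h.add hρ hβ
  have hiter := iterate_deriv_cpow_mul_gammaSeries w (B := B) hα n hs
    (f := fun y : ℝ => (1 / Complex.Gamma ((n : ℂ) - μ)) *
      ∫ t in B..y, ((y - t : ℝ) : ℂ) ^ ((n : ℂ) - μ - 1) *
        (((t - B : ℝ) : ℂ) ^ (ρ - 1) * gammaSeries A k ρ (w * ((t : ℂ) - B))))
    (fun y hy => by
      simp only
      rw [integral_rlKernel_mul_gammaSeries h hρ hβ w hy, hadd]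
      field_simp)
  exact ⟨hiter.1, hiter.2 hY⟩

end GammaSeries

/-- The coefficients of `mlE3` without the Gamma factor. -/
noncomputable def mlE3Coeff (γ1 γ2 γ3 X : ℂ) (p : ℕ × ℕ) : ℂ :=
  poch γ1 (2 * p.1) * poch γ2 (p.1 + p.2) * X ^ p.1 /
    (poch γ3 p.1 * (p.2.factorial : ℂ) * (p.1.factorial : ℂ))

lemma mlE3Coeff_mul_div_Gamma (ρ γ1 γ2 γ3 X z : ℂ) (Υ : ℕ) (p : ℕ × ℕ) :
    mlE3Coeff γ1 γ2 γ3 X p * z ^ (Υ * p.2) / Complex.Gamma (ρ + ((Υ * p.2 : ℕ) : ℂ)) =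
      poch γ1 (2 * p.1) * poch γ2 (p.1 + p.2) * X ^ p.1 * z ^ (Υ * p.2) /
        (poch γ3 p.1 * Complex.Gamma (ρ + (Υ : ℂ) * p.2) *
          (p.2.factorial : ℂ) * (p.1.factorial : ℂ)) := by
  rw [mlE3Coeff, Nat.cast_mul]
  simp only [div_eq_mul_inv, mul_inv]
  ring

lemma mlE3_eq_gammaSeries {ρ γ1 γ2 γ3 X : ℂ} {Υ : ℕ}
    (h : GammaSummable (mlE3Coeff γ1 γ2 γ3 X) (fun p => Υ * p.2) ρ) (z : ℂ) :
    mlE3 ρ Υ γ1 γ2 γ3 X z = gammaSeries (mlE3Coeff γ1 γ2 γ3 X) (fun p => Υ * p.2) ρ z := by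
  rw [gammaSeries, (h z).tsum_prod, mlE3]
  exact tsum_congr fun s => tsum_congr fun r =>
    (mlE3Coeff_mul_div_Gamma ρ γ1 γ2 γ3 X z Υ (s, r)).symm

/-- Riemann–Liouville fractional derivative image of the bivariate H-K
Mittag-Leffler function:
`D^μ_{B+}[(Y-B)^{ρ-1} E_{ρ,Υ}(X, w(Y-B))] = (Y-B)^{ρ-μ-1} E_{ρ-μ,Υ}(X, w(Y-B))`. -/
theorem riemannLiouville_deriv_mlE3 (ρ μ γ1 γ2 γ3 X w : ℂ) (Υ : ℕ) (hΥ : 0 < Υ)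
    (hμ : 0 ≤ μ.re) (hρμ : μ.re < ρ.re) (B Y : ℝ) (hY : B < Y)
    (hS : ∀ z : ℂ, Summable (fun p : ℕ × ℕ =>
      poch γ1 (2 * p.1) * poch γ2 (p.1 + p.2) * X ^ p.1 * z ^ (Υ * p.2) /
        (poch γ3 p.1 * Complex.Gamma (ρ + (Υ : ℂ) * p.2) *
          (p.2.factorial : ℂ) * (p.1.factorial : ℂ)))) :
    rlDeriv μ B
        (fun t : ℝ => ((t - B : ℝ) : ℂ) ^ (ρ - 1) * mlE3 ρ Υ γ1 γ2 γ3 X (w * ((t : ℂ) - B)))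
        Y =
      ((Y - B : ℝ) : ℂ) ^ (ρ - μ - 1) * mlE3 (ρ - μ) Υ γ1 γ2 γ3 X (w * ((Y : ℂ) - B)) := by
  have h : GammaSummable (mlE3Coeff γ1 γ2 γ3 X) (fun p => Υ * p.2) ρ := fun z => by
    simpa only [mlE3Coeff_mul_div_Gamma] using hS z
  obtain ⟨h', hD⟩ := rlDeriv_cpow_mul_gammaSeries h hμ hρμ w hY
  simpa only [mlE3_eq_gammaSeries h, mlE3_eq_gammaSeries h'] using hD
end
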